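/- arXiv:1909.05570 — 3 statements merged into one kernel-verified Lean document; each statement's English description precedes it below -/
import Mathlib

section
/- For every c ∈ (0,1), the equation L'(λ) = c has the unique real solution λ_c = c/(1-c²), and at this point L''(λ_c) = (1-c²)²/(1+c²). -/
open Real Filter

/-- The limiting normalized cumulant generating function `L`. -/
noncomputable def Lfun (l : ℝ) : ℝ :=
  (-1 + Real.sqrt (1 + 4 * l ^ 2)) / 2
    - (1 / 2) * Real.log ((1 + Real.sqrt (1 + 4 * l ^ 2)) / 4)

theorem hasDerivAt_sqrt_one_add_four_mul_sq (l : ℝ) :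
    HasDerivAt (fun x : ℝ => √(1 + 4 * x ^ 2)) (4 * l / √(1 + 4 * l ^ 2)) l := by
  have h : HasDerivAt (fun x : ℝ => 1 + 4 * x ^ 2) (8 * l) l := by
    refine (((hasDerivAt_pow 2 l).const_mul 4).const_add 1).congr_deriv ?_
    norm_num
    ring
  convert h.sqrt (by positivity) using 1
  have : 0 < √(1 + 4 * l ^ 2) := by positivity
  field_simp
  ring

theorem hasDerivAt_Lfun (l : ℝ) :
    HasDerivAt Lfun (2 * l / (1 + √(1 + 4 * l ^ 2))) l := by
  have hs := hasDerivAt_sqrt_one_add_four_mul_sq l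
  have hpos : 0 < √(1 + 4 * l ^ 2) := by positivity
  have hlog := ((hs.const_add 1).div_const 4).log (by positivity)
  refine (((hs.const_add (-1)).div_const 2).sub (hlog.const_mul (1 / 2))).congr_deriv ?_
  field_simp
  ring

theorem deriv_Lfun : deriv Lfun = fun l => 2 * l / (1 + √(1 + 4 * l ^ 2)) :=
  funext fun l => (hasDerivAt_Lfun l).deriv

theorem hasDerivAt_deriv_Lfun (l : ℝ) :
    HasDerivAt (deriv Lfun) (2 / (√(1 + 4 * l ^ 2) * (1 + √(1 + 4 * l ^ 2)))) l := by
  have hs := hasDerivAt_sqrt_one_add_four_mul_sq l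
  have hpos : 0 < √(1 + 4 * l ^ 2) := by positivity
  have hsq : √(1 + 4 * l ^ 2) ^ 2 = 1 + 4 * l ^ 2 := Real.sq_sqrt (by positivity)
  rw [deriv_Lfun]
  refine (((hasDerivAt_id' l).const_mul 2).div (hs.const_add 1) (by positivity)).congr_deriv ?_
  generalize √(1 + 4 * l ^ 2) = s at *
  field_simp
  linear_combination hsq

theorem sqrt_one_add_four_mul_div_sq {c : ℝ} (hc : c ^ 2 < 1) :
    √(1 + 4 * (c / (1 - c ^ 2)) ^ 2) = (1 + c ^ 2) / (1 - c ^ 2) := by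
  have h : 0 < 1 - c ^ 2 := sub_pos.2 hc
  rw [Real.sqrt_eq_iff_mul_self_eq (by positivity) (by positivity)]
  field_simp
  ring

theorem stmt_3 (c : ℝ) (hc : c ∈ Set.Ioo (0 : ℝ) 1) :
    deriv Lfun (c / (1 - c ^ 2)) = c ∧
    (∀ l : ℝ, deriv Lfun l = c → l = c / (1 - c ^ 2)) ∧
    deriv (deriv Lfun) (c / (1 - c ^ 2)) = (1 - c ^ 2) ^ 2 / (1 + c ^ 2) := by
  obtain ⟨h0, h1⟩ := hc
  have hlt : c ^ 2 < 1 := by nlinarith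
  have hpos : 0 < 1 - c ^ 2 := sub_pos.2 hlt
  have hsum : 1 + (1 + c ^ 2) / (1 - c ^ 2) = 2 / (1 - c ^ 2) := by
    field_simp
    ring
  refine ⟨?_, fun l hl => ?_, ?_⟩
  · rw [(hasDerivAt_Lfun _).deriv, sqrt_one_add_four_mul_div_sq hlt, hsum]
    field_simp
  · rw [(hasDerivAt_Lfun l).deriv] at hl
    have hs : 0 < √(1 + 4 * l ^ 2) := by positivity
    have hsq : √(1 + 4 * l ^ 2) ^ 2 = 1 + 4 * l ^ 2 := Real.sq_sqrt (by positivity)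
    generalize √(1 + 4 * l ^ 2) = s at *
    rw [div_eq_iff (by positivity)] at hl
    have hl0 : l ≠ 0 := by
      rintro rfl
      have : 0 < c * (1 + s) := by positivity
      linarith
    rw [eq_div_iff hpos.ne']
    refine mul_left_cancel₀ hl0 ?_
    linear_combination (2 * l - c + c * s) / 4 * hl + c ^ 2 / 4 * hsq
  · rw [(hasDerivAt_deriv_Lfun _).deriv, sqrt_one_add_four_mul_div_sq hlt, hsum]
    field_simp
end

section
/- For every c ∈ (0,1), as n → ∞, Γ(n/2)/(√π · Γ((n-1)/2)) · ∫_{c}^{1} (1-r²)^{(n-3)/2} dr = (1-c²)^{n/2} · (1+4λ_c²)^{-1/4} · ((1+√(1+4λ_c²))/2) / (λ_c σ_c √(2πn)) · (1 + o(1)), where λ_c = c/(1-c²) and σ_c = (1-c²)/√(1+c²). (The left-hand side is P(r̃_n ≥ c) for the known-expectation empirical correlation coefficient in the spherical model, and (1-c²)^{n/2} = e^{-n L*(c)} with L*(c) = -(1/2)log(1-c²).) -/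
open Real Filter

theorem tendsto_Gamma_add_half_div_Gamma :
    Tendsto (fun x : ℝ => Gamma (x + 1 / 2) / (Gamma x * √x)) atTop (nhds 1) := by
  have midpoint {s t : ℝ} (hs : 0 < s) (ht : 0 < t) :
      Gamma ((s + t) / 2) ^ 2 ≤ Gamma s * Gamma t := by
    have h := Gamma_mul_add_mul_le_rpow_Gamma_mul_rpow_Gamma hs ht
      (a := 1 / 2) (b := 1 / 2) (by norm_num) (by norm_num) (by norm_num)
    rw [← sqrt_eq_rpow, ← sqrt_eq_rpow, ← sqrt_mul (Gamma_pos_of_pos hs).le,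
      show 1 / 2 * s + 1 / 2 * t = (s + t) / 2 by ring] at h
    have hst := mul_pos (Gamma_pos_of_pos hs) (Gamma_pos_of_pos ht)
    exact (le_sqrt (Gamma_pos_of_pos (by positivity)).le hst.le).1 h
  have lower : Tendsto (fun x : ℝ => √(1 - (1 / 2) / (x + 1 / 2))) atTop (nhds 1) := by
    have h : Tendsto (fun x : ℝ => 1 - (1 / 2) / (x + 1 / 2)) atTop (nhds (1 - 0)) :=
      tendsto_const_nhds.sub
        (tendsto_const_nhds.div_atTop (tendsto_atTop_add_const_right _ _ tendsto_id))
    simpa using h.sqrt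
  refine tendsto_of_tendsto_of_tendsto_of_le_of_le' lower tendsto_const_nhds ?_ ?_
  · filter_upwards [eventually_gt_atTop 0] with x hx
    have hG := Gamma_pos_of_pos hx
    have hG' := Gamma_pos_of_pos (show 0 < x + 1 / 2 by positivity)
    have h := midpoint (show 0 < x + 1 / 2 by positivity) (show 0 < x + 1 / 2 + 1 by positivity)
    rw [show (x + 1 / 2 + (x + 1 / 2 + 1)) / 2 = x + 1 by ring, Gamma_add_one hx.ne',
      Gamma_add_one (by positivity)] at h
    refine sqrt_le_iff.2 ⟨by positivity, ?_⟩
    rw [div_pow, mul_pow, sq_sqrt hx.le,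
      show 1 - 1 / 2 / (x + 1 / 2) = x / (x + 1 / 2) by field_simp; ring,
      div_le_div_iff₀ (by positivity) (by positivity)]
    nlinarith
  · filter_upwards [eventually_gt_atTop 0] with x hx
    have hG := Gamma_pos_of_pos hx
    have h := midpoint hx (show 0 < x + 1 by positivity)
    rw [show (x + (x + 1)) / 2 = x + 1 / 2 by ring, Gamma_add_one hx.ne'] at h
    refine div_le_one_of_le₀ (abs_le_of_sq_le_sq' ?_ (by positivity)).2 (by positivity)
    rw [mul_pow, sq_sqrt hx.le]
    linarith

theorem continuous_one_sub_sq_rpow {p : ℝ} (hp : 0 ≤ p) :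
    Continuous fun r : ℝ => (1 - r ^ 2) ^ p :=
  Continuous.rpow_const (by fun_prop) fun _ => Or.inr hp

theorem integral_mul_one_sub_sq_rpow (c : ℝ) {p : ℝ} (hp : 1 ≤ p) :
    ∫ r in c..(1 : ℝ), r * (1 - r ^ 2) ^ (p - 1) = (1 - c ^ 2) ^ p / (2 * p) := by
  have hp0 : p ≠ 0 := by positivity
  have deriv (r : ℝ) :
      HasDerivAt (fun r : ℝ => -(1 - r ^ 2) ^ p / (2 * p)) (r * (1 - r ^ 2) ^ (p - 1)) r := by
    have h := ((((hasDerivAt_pow 2 r).const_sub 1).rpow_const (Or.inr hp)).neg).div_const (2 * p)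
    refine h.congr_deriv ?_
    field_simp
    norm_num
    ring
  rw [intervalIntegral.integral_eq_sub_of_hasDerivAt (fun r _ => deriv r)
    ((continuous_id.mul (continuous_one_sub_sq_rpow (by linarith))).intervalIntegrable _ _)]
  simp [zero_rpow hp0, neg_div]

theorem integral_one_sub_sq_rpow_le {c p : ℝ} (hc : c ∈ Set.Ioo (0 : ℝ) 1) (hp : 1 ≤ p) :
    ∫ r in c..(1 : ℝ), (1 - r ^ 2) ^ (p - 1) ≤ (1 - c ^ 2) ^ p / (2 * p * c) := by
  obtain ⟨hc0, hc1⟩ := hc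
  have hcont := continuous_one_sub_sq_rpow (show 0 ≤ p - 1 by linarith)
  calc
    _ ≤ ∫ r in c..(1 : ℝ), c⁻¹ * (r * (1 - r ^ 2) ^ (p - 1)) := by
      refine intervalIntegral.integral_mono_on hc1.le (hcont.intervalIntegrable _ _)
        ((continuous_const.mul (continuous_id.mul hcont)).intervalIntegrable _ _) fun r hr => ?_
      have hpos : 0 ≤ (1 - r ^ 2) ^ (p - 1) := rpow_nonneg (by nlinarith [hr.1, hr.2]) _
      rw [← mul_assoc]
      refine le_mul_of_one_le_left hpos ?_
      rw [inv_mul_eq_div, one_le_div hc0]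
      exact hr.1
    _ = _ := by
      rw [intervalIntegral.integral_const_mul, integral_mul_one_sub_sq_rpow c hp]
      field_simp

theorem le_integral_one_sub_sq_rpow {c p : ℝ} (hc : c ∈ Set.Ioo (0 : ℝ) 1) (hp : 1 ≤ p) :
    (1 - c ^ 2) ^ p / (2 * p * c) * (1 - (1 - c ^ 2) / (2 * c ^ 2) / (p + 1)) ≤
      ∫ r in c..(1 : ℝ), (1 - r ^ 2) ^ (p - 1) := by
  obtain ⟨hc0, hc1⟩ := hc
  have hcont := continuous_one_sub_sq_rpow (show 0 ≤ p - 1 by linarith)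
  have hcont' := continuous_one_sub_sq_rpow (show 0 ≤ p + 1 - 1 by linarith)
  have hbase : 0 < 1 - c ^ 2 := by nlinarith
  have hint : IntervalIntegrable (fun r : ℝ => r * (1 - r ^ 2) ^ (p - 1)) MeasureTheory.volume c 1 :=
    (continuous_id.mul hcont).intervalIntegrable _ _
  have hint' : IntervalIntegrable (fun r : ℝ => r * (1 - r ^ 2) ^ (p + 1 - 1)) MeasureTheory.volume c 1 :=
    (continuous_id.mul hcont').intervalIntegrable _ _
  set a := 1 / c - (1 - c ^ 2) / (2 * c ^ 3) with ha
  set b := 1 / (2 * c ^ 3) with hb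
  calc
    _ = ∫ r in c..(1 : ℝ),
        (a * (r * (1 - r ^ 2) ^ (p - 1)) + b * (r * (1 - r ^ 2) ^ (p + 1 - 1))) := by
      rw [intervalIntegral.integral_add (hint.const_mul a) (hint'.const_mul b),
        intervalIntegral.integral_const_mul, intervalIntegral.integral_const_mul,
        integral_mul_one_sub_sq_rpow c hp, integral_mul_one_sub_sq_rpow c (by linarith),
        rpow_add_one hbase.ne', ha, hb]
      have : p + 1 ≠ 0 := by positivity
      field_simp
      ring
    _ ≤ _ := by
      refine intervalIntegral.integral_mono_on hc1.le
        ((hint.const_mul a).add (hint'.const_mul b))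
        (hcont.intervalIntegrable _ _) fun r hr => ?_
      obtain ⟨hcr, hr1⟩ := hr
      have hr0 : 0 < r := hc0.trans_le hcr
      have hr2 : 0 ≤ 1 - r ^ 2 := by nlinarith
      have hpow : (1 - r ^ 2) ^ (p + 1 - 1) = (1 - r ^ 2) ^ (p - 1) * (1 - r ^ 2) := by
        rw [← rpow_add_one' hr2 (by linarith)]
        ring_nf
      rw [hpow]
      have tangent : r * (a + b * (1 - r ^ 2)) ≤ 1 := by
        rw [ha, hb, show r * (1 / c - (1 - c ^ 2) / (2 * c ^ 3) + 1 / (2 * c ^ 3) * (1 - r ^ 2)) =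
          r * (3 * c ^ 2 - r ^ 2) / (2 * c ^ 3) by field_simp; ring, div_le_one (by positivity)]
        nlinarith [mul_nonneg (sq_nonneg (r - c)) (show 0 ≤ r + 2 * c by positivity)]
      calc
        _ = r * (a + b * (1 - r ^ 2)) * (1 - r ^ 2) ^ (p - 1) := by ring
        _ ≤ _ := mul_le_of_le_one_left (rpow_nonneg hr2 _) tangent

theorem tendsto_integral_one_sub_sq_rpow {c : ℝ} (hc : c ∈ Set.Ioo (0 : ℝ) 1) :
    Tendsto (fun p : ℝ => (∫ r in c..(1 : ℝ), (1 - r ^ 2) ^ (p - 1)) /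
      ((1 - c ^ 2) ^ p / (2 * p * c))) atTop (nhds 1) := by
  have hc0 := hc.1
  have hbase : 0 < 1 - c ^ 2 := by nlinarith [hc.1, hc.2]
  have lower : Tendsto (fun p : ℝ => 1 - (1 - c ^ 2) / (2 * c ^ 2) / (p + 1)) atTop
      (nhds 1) := by
    simpa using (tendsto_const_nhds (x := (1 : ℝ))).sub
      ((tendsto_const_nhds (x := (1 - c ^ 2) / (2 * c ^ 2))).div_atTop
        (tendsto_atTop_add_const_right _ (1 : ℝ) tendsto_id))
  refine tendsto_of_tendsto_of_tendsto_of_le_of_le' lower tendsto_const_nhds ?_ ?_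
  · filter_upwards [eventually_ge_atTop 1] with p hp
    rw [le_div_iff₀ (by positivity), mul_comm]
    exact le_integral_one_sub_sq_rpow hc hp
  · filter_upwards [eventually_ge_atTop 1] with p hp
    exact div_le_one_of_le₀ (integral_one_sub_sq_rpow_le hc hp) (by positivity)

theorem saddlepoint_prefactor_eq {c : ℝ} (hc : c ∈ Set.Ioo (0 : ℝ) 1) (x : ℝ) :
    (1 - c ^ 2) ^ (x / 2)
        * (1 + 4 * (c / (1 - c ^ 2)) ^ 2) ^ (-(1 / 4) : ℝ)
        * ((1 + √(1 + 4 * (c / (1 - c ^ 2)) ^ 2)) / 2)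
        / ((c / (1 - c ^ 2)) * ((1 - c ^ 2) / √(1 + c ^ 2)) * √(2 * π * x))
      = (1 - c ^ 2) ^ ((x - 1) / 2) / (c * √(2 * π * x)) := by
  have hc0 := hc.1
  have hbase : 0 < 1 - c ^ 2 := by nlinarith [hc.1, hc.2]
  have hsq : 1 + 4 * (c / (1 - c ^ 2)) ^ 2 = ((1 + c ^ 2) / (1 - c ^ 2)) ^ 2 := by
    field_simp
    ring
  have hquarter : (((1 + c ^ 2) / (1 - c ^ 2)) ^ 2) ^ (-(1 / 4) : ℝ) =
      √(1 - c ^ 2) / √(1 + c ^ 2) := by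
    rw [← rpow_natCast, ← rpow_mul (by positivity), ← sqrt_div hbase.le, sqrt_eq_rpow,
      ← inv_div (1 + c ^ 2), inv_rpow (by positivity), ← rpow_neg (by positivity)]
    norm_num
  rw [hsq, hquarter, sqrt_sq (by positivity), show (x - 1) / 2 = x / 2 - 1 / 2 by ring,
    rpow_sub hbase, ← sqrt_eq_rpow]
  have hs : √(1 - c ^ 2) ^ 2 = 1 - c ^ 2 := sq_sqrt hbase.le
  have hs0 : 0 < √(1 - c ^ 2) := sqrt_pos.2 hbase
  have hhalf : (1 + (1 + c ^ 2) / (1 - c ^ 2)) / 2 = (√(1 - c ^ 2) ^ 2)⁻¹ := by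
    rw [hs]
    field_simp
    ring
  have hcancel : c / (1 - c ^ 2) * ((1 - c ^ 2) / √(1 + c ^ 2)) = c / √(1 + c ^ 2) := by
    field_simp
  rw [hhalf, hcancel]
  have : 0 < √(1 + c ^ 2) := by positivity
  field_simp

theorem stmt_8 (c : ℝ) (hc : c ∈ Set.Ioo (0 : ℝ) 1) :
    ∃ ε : ℕ → ℝ, Tendsto ε atTop (nhds 0) ∧
      ∀ᶠ n : ℕ in atTop,
        Real.Gamma ((n : ℝ) / 2) / (Real.sqrt π * Real.Gamma (((n : ℝ) - 1) / 2)) *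
            ∫ r in c..(1 : ℝ), (1 - r ^ 2) ^ (((n : ℝ) - 3) / 2)
          = (1 - c ^ 2) ^ ((n : ℝ) / 2)
              * (1 + 4 * (c / (1 - c ^ 2)) ^ 2) ^ (-(1 / 4) : ℝ)
              * ((1 + Real.sqrt (1 + 4 * (c / (1 - c ^ 2)) ^ 2)) / 2)
              / ((c / (1 - c ^ 2)) * ((1 - c ^ 2) / Real.sqrt (1 + c ^ 2))
                  * Real.sqrt (2 * π * n))
              * (1 + ε n) := by
  obtain ⟨hc0, hc1⟩ := id hc
  have hbase : 0 < 1 - c ^ 2 := by nlinarith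
  have hp : Tendsto (fun n : ℕ => ((n : ℝ) - 1) / 2) atTop atTop :=
    (tendsto_atTop_add_const_right _ (-1) tendsto_natCast_atTop_atTop).atTop_div_const two_pos
  have hroot : Tendsto (fun n : ℕ => √(1 + (1 / 2) / (((n : ℝ) - 1) / 2))) atTop (nhds 1) := by
    simpa using ((tendsto_const_nhds (x := (1 : ℝ))).add
      ((tendsto_const_nhds (x := (1 / 2 : ℝ))).div_atTop hp)).sqrt
  have hlim := ((tendsto_Gamma_add_half_div_Gamma.comp hp).mul
    ((tendsto_integral_one_sub_sq_rpow hc).comp hp)).mul hroot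
  have herr := hlim.sub_const 1
  rw [show (1 : ℝ) * 1 * 1 - 1 = 0 by norm_num] at herr
  refine ⟨_, herr, ?_⟩
  filter_upwards [eventually_ge_atTop 2] with n hn
  have hn' : (2 : ℝ) ≤ n := by exact_mod_cast hn
  rw [saddlepoint_prefactor_eq hc]
  simp only [Function.comp_apply]
  have hn_eq : (n : ℝ) = 2 * (((n : ℝ) - 1) / 2) + 1 := by ring
  rw [show ((n : ℝ) - 3) / 2 = ((n : ℝ) - 1) / 2 - 1 by ring,
    show (n : ℝ) / 2 = ((n : ℝ) - 1) / 2 + 1 / 2 by ring]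
  set p := ((n : ℝ) - 1) / 2 with hp_def
  have hp0 : 0 < p := by rw [hp_def]; linarith
  have hsqrt : √(2 * π * n) = 2 * √π * √p * √(1 + 1 / 2 / p) := by
    rw [hn_eq, show 2 * π * (2 * p + 1) = 2 ^ 2 * π * p * (1 + 1 / 2 / p) by field_simp,
      sqrt_mul (by positivity), sqrt_mul (by positivity), sqrt_mul (by positivity),
      sqrt_sq two_pos.le]
  have hG := Gamma_pos_of_pos hp0
  have hsp : √p ^ 2 = p := sq_sqrt hp0.le
  have hpow : 0 < (1 - c ^ 2) ^ p := by positivity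
  have hr : 0 < √(1 + 1 / 2 / p) := by positivity
  have hsp0 : 0 < √p := by positivity
  have hpi : 0 < √π := by positivity
  rw [hsqrt]
  generalize √(1 + 1 / 2 / p) = u at *
  generalize (∫ r in c..(1 : ℝ), (1 - r ^ 2) ^ (p - 1)) = I at *
  generalize (1 - c ^ 2) ^ p = w at *
  rw [add_sub_cancel]
  field_simp
  rw [hsp]
  ring
end

section
/- For ρ ∈ (-1,1), define I_ρ(s) = log( (1-ρs) / (√(1-ρ²) √(1-s²)) ) for s ∈ (-1,1). Then I_ρ is convex on (-1,1) if and only if |ρ| ≤ ρ_0, where ρ_0 = √(3+2√3)/3. -/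
open Real Filter

/-- On an open interval, a twice differentiable function is convex iff its second derivative is
nonnegative. -/
lemma convexOn_Ioo_iff_of_hasDerivAt {a b : ℝ} {f f' f'' : ℝ → ℝ}
    (hf : ∀ s ∈ Set.Ioo a b, HasDerivAt f (f' s) s)
    (hf' : ∀ s ∈ Set.Ioo a b, HasDerivAt f' (f'' s) s) :
    ConvexOn ℝ (Set.Ioo a b) f ↔ ∀ s ∈ Set.Ioo a b, 0 ≤ f'' s := by
  constructor
  · intro h s hs
    have hmono : MonotoneOn f' (Set.Ioo a b) := by
      refine (h.monotoneOn_deriv fun x hx => (hf x hx).differentiableAt).congr ?_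
      exact fun x hx => (hf x hx).deriv
    have := hmono.derivWithin_nonneg (x := s)
    rwa [((hf' s hs).hasDerivWithinAt).derivWithin (isOpen_Ioo.uniqueDiffWithinAt hs)] at this
  · intro h
    refine convexOn_of_hasDerivWithinAt2_nonneg (f' := f') (f'' := f'') (convex_Ioo a b)
      (fun s hs => (hf s hs).continuousAt.continuousWithinAt) ?_ ?_ ?_
    · rw [interior_Ioo]; exact fun s hs => (hf s hs).hasDerivWithinAt
    · rw [interior_Ioo]; exact fun s hs => (hf' s hs).hasDerivWithinAt
    · rw [interior_Ioo]; exact h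

lemma one_sub_mul_pos {ρ s : ℝ} (hρ : ρ ∈ Set.Ioo (-1 : ℝ) 1) (hs : s ∈ Set.Ioo (-1 : ℝ) 1) :
    0 < 1 - ρ * s := by
  obtain ⟨h1, h2⟩ := hρ
  obtain ⟨h3, h4⟩ := hs
  nlinarith [mul_pos (sub_pos.2 h2) (neg_lt_iff_pos_add.1 h3),
    mul_pos (neg_lt_iff_pos_add.1 h1) (sub_pos.2 h4)]

lemma one_sub_sq_pos {s : ℝ} (hs : s ∈ Set.Ioo (-1 : ℝ) 1) : 0 < 1 - s ^ 2 := by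
  nlinarith [hs.1, hs.2]

lemma log_correlation_rate_eq {ρ s : ℝ} (hρ : ρ ∈ Set.Ioo (-1 : ℝ) 1)
    (hs : s ∈ Set.Ioo (-1 : ℝ) 1) :
    log ((1 - ρ * s) / (√(1 - ρ ^ 2) * √(1 - s ^ 2))) =
      log (1 - ρ * s) - log (1 - s ^ 2) / 2 - log (1 - ρ ^ 2) / 2 := by
  have h1 := one_sub_sq_pos hρ
  have h2 := one_sub_sq_pos hs
  rw [log_div (one_sub_mul_pos hρ hs).ne' (by positivity), log_mul (by positivity) (by positivity),
    log_sqrt h1.le, log_sqrt h2.le]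
  ring

lemma hasDerivAt_log_sub_log {ρ s : ℝ} (c : ℝ) (hρ : ρ ∈ Set.Ioo (-1 : ℝ) 1)
    (hs : s ∈ Set.Ioo (-1 : ℝ) 1) :
    HasDerivAt (fun s => log (1 - ρ * s) - log (1 - s ^ 2) / 2 - c)
      (s / (1 - s ^ 2) - ρ / (1 - ρ * s)) s := by
  have h1 := one_sub_mul_pos hρ hs
  have h2 := one_sub_sq_pos hs
  have d1 : HasDerivAt (fun s : ℝ => 1 - ρ * s) (-ρ) s := by
    simpa using ((hasDerivAt_id s).const_mul ρ).const_sub 1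
  have d2 : HasDerivAt (fun s : ℝ => 1 - s ^ 2) (-(2 * s)) s := by
    simpa using (hasDerivAt_pow 2 s).const_sub 1
  refine (((d1.log h1.ne').sub ((d2.log h2.ne').div_const 2)).sub_const c).congr_deriv ?_
  field_simp
  ring

lemma hasDerivAt_div_sub_div {ρ s : ℝ} (hρ : ρ ∈ Set.Ioo (-1 : ℝ) 1)
    (hs : s ∈ Set.Ioo (-1 : ℝ) 1) :
    HasDerivAt (fun s => s / (1 - s ^ 2) - ρ / (1 - ρ * s))
      (((1 + s ^ 2) * (1 - ρ * s) ^ 2 - ρ ^ 2 * (1 - s ^ 2) ^ 2) /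
        ((1 - s ^ 2) ^ 2 * (1 - ρ * s) ^ 2)) s := by
  have h1 := one_sub_mul_pos hρ hs
  have h2 := one_sub_sq_pos hs
  have d1 : HasDerivAt (fun s : ℝ => 1 - ρ * s) (-ρ) s := by
    simpa using ((hasDerivAt_id s).const_mul ρ).const_sub 1
  have d2 : HasDerivAt (fun s : ℝ => 1 - s ^ 2) (-(2 * s)) s := by
    simpa using (hasDerivAt_pow 2 s).const_sub 1
  refine (((hasDerivAt_id' s).div d2 h2.ne').sub
    ((hasDerivAt_const s ρ).div d1 h1.ne')).congr_deriv ?_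
  rw [div_sub_div _ _ (pow_ne_zero 2 h2.ne') (pow_ne_zero 2 h1.ne')]
  congr 1
  ring

/-- The positive root `a` of `3 a ^ 4 + 6 a ^ 2 = 1` is the minimiser at the critical correlation
`1 / (3 a)`. -/
lemma forall_rate_numerator_nonneg_iff {r a : ℝ} (hr : 0 ≤ r) (hr1 : r < 1) (ha : 0 < a)
    (h : 3 * a ^ 4 + 6 * a ^ 2 = 1) :
    (∀ s ∈ Set.Ioo (-1 : ℝ) 1, 0 ≤ (1 + s ^ 2) * (1 - r * s) ^ 2 - r ^ 2 * (1 - s ^ 2) ^ 2) ↔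
      3 * a * r ≤ 1 := by
  have ha2 : a < 2 / 5 := by
    by_contra! hc
    nlinarith [pow_le_pow_left₀ (by norm_num) hc 2, pow_le_pow_left₀ (by norm_num) hc 4]
  have ha3 : 1 / 3 < a := by
    by_contra! hc
    nlinarith [pow_le_pow_left₀ ha.le hc 2, pow_le_pow_left₀ ha.le hc 4]
  constructor
  · intro hP
    by_contra! hc
    have h1 := hP a ⟨by linarith, by linarith⟩
    have h2 : 0 < 1 - r * a := by nlinarith [mul_lt_mul_of_pos_right hr1 ha]
    have h3 : (1 - r * a) ^ 2 < (2 * a * r) ^ 2 :=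
      pow_lt_pow_left₀ (by linarith) h2.le two_ne_zero
    have h4 : (1 - a ^ 2) ^ 2 = 4 * a ^ 2 * (1 + a ^ 2) := by linear_combination -h
    rw [h4] at h1
    nlinarith [mul_lt_mul_of_pos_left h3 (show 0 < 1 + a ^ 2 by positivity)]
  · rintro hc s ⟨-, hs⟩
    have h1 : (r * (3 * a - s)) ^ 2 ≤ (1 - r * s) ^ 2 :=
      pow_le_pow_left₀ (mul_nonneg hr (by linarith)) (by linarith) 2
    have h2 : 0 ≤ 1 - a ^ 2 - 2 * a * s := by nlinarith
    have h3 : (1 + s ^ 2) * (3 * a - s) ^ 2 - (1 - s ^ 2) ^ 2 =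
        3 * (s - a) ^ 2 * (1 - a ^ 2 - 2 * a * s) := by
      linear_combination h
    have h4 : 0 ≤ r ^ 2 * (3 * (s - a) ^ 2 * (1 - a ^ 2 - 2 * a * s)) := by positivity
    rw [← h3] at h4
    nlinarith [mul_le_mul_of_nonneg_left h1 (show 0 ≤ 1 + s ^ 2 by positivity)]

lemma forall_rate_numerator_abs_iff (ρ : ℝ) :
    (∀ s ∈ Set.Ioo (-1 : ℝ) 1, 0 ≤ (1 + s ^ 2) * (1 - |ρ| * s) ^ 2 - |ρ| ^ 2 * (1 - s ^ 2) ^ 2) ↔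
      ∀ s ∈ Set.Ioo (-1 : ℝ) 1, 0 ≤ (1 + s ^ 2) * (1 - ρ * s) ^ 2 - ρ ^ 2 * (1 - s ^ 2) ^ 2 := by
  rcases abs_choice ρ with h | h
  · rw [h]
  · rw [h]
    constructor <;> intro H s hs <;>
      simpa using H (-s) ⟨by linarith [hs.2], by linarith [hs.1]⟩

theorem stmt_10 (ρ : ℝ) (hρ : ρ ∈ Set.Ioo (-1 : ℝ) 1) :
    ConvexOn ℝ (Set.Ioo (-1 : ℝ) 1)
        (fun s : ℝ =>
          Real.log ((1 - ρ * s) / (Real.sqrt (1 - ρ ^ 2) * Real.sqrt (1 - s ^ 2)))) ↔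
      |ρ| ≤ Real.sqrt (3 + 2 * Real.sqrt 3) / 3 := by
  have hd : ∀ s ∈ Set.Ioo (-1 : ℝ) 1, HasDerivAt
      (fun s : ℝ => log ((1 - ρ * s) / (√(1 - ρ ^ 2) * √(1 - s ^ 2))))
      (s / (1 - s ^ 2) - ρ / (1 - ρ * s)) s := fun s hs =>
    (hasDerivAt_log_sub_log _ hρ hs).congr_of_eventuallyEq <|
      (isOpen_Ioo.eventually_mem hs).mono fun t ht => log_correlation_rate_eq hρ ht
  rw [convexOn_Ioo_iff_of_hasDerivAt hd fun s hs => hasDerivAt_div_sub_div hρ hs]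
  have hnum : (∀ s ∈ Set.Ioo (-1 : ℝ) 1,
      0 ≤ ((1 + s ^ 2) * (1 - ρ * s) ^ 2 - ρ ^ 2 * (1 - s ^ 2) ^ 2) /
        ((1 - s ^ 2) ^ 2 * (1 - ρ * s) ^ 2)) ↔
      ∀ s ∈ Set.Ioo (-1 : ℝ) 1,
        0 ≤ (1 + s ^ 2) * (1 - ρ * s) ^ 2 - ρ ^ 2 * (1 - s ^ 2) ^ 2 := by
    refine forall₂_congr fun s hs => ?_
    have h1 := one_sub_mul_pos hρ hs
    have h2 := one_sub_sq_pos hs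
    rw [le_div_iff₀ (by positivity), zero_mul]
  rw [hnum, ← forall_rate_numerator_abs_iff]
  set b : ℝ := √(3 + 2 * √3) / 3 with hb
  have hb0 : 0 < b := by positivity
  have hb2 : 9 * b ^ 2 = 3 + 2 * √3 := by
    rw [hb, div_pow, sq_sqrt (by positivity)]
    ring
  have hb4 : 27 * b ^ 4 - 18 * b ^ 2 = 1 := by
    have h3 : √3 ^ 2 = 3 := sq_sqrt (by norm_num)
    linear_combination (b ^ 2 * 3 - 1 + 2 / 3 * √3) * hb2 + 4 / 3 * h3
  have ha : 3 * (1 / (3 * b)) ^ 4 + 6 * (1 / (3 * b)) ^ 2 = 1 := by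
    field_simp
    linear_combination -hb4
  rw [forall_rate_numerator_nonneg_iff (abs_nonneg ρ) (abs_lt.2 hρ) (by positivity) ha,
    show 3 * (1 / (3 * b)) * |ρ| = |ρ| / b by field_simp, div_le_one hb0]
end
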